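/- arXiv:0908.0091 — 4 statements merged into one kernel-verified Lean document; each statement's English description precedes it below -/
import Mathlib

section
/- Let $F$ be a field of characteristic zero and let $F \subseteq K_{n-1} \subseteq K_n$ be finite field extensions such that both $K_{n-1}/F$ and $K_n/F$ are Galois. Let $G_n = \mathrm{Gal}(K_n/F)$, let $d = [K_n : K_{n-1}]$, and let $\pi_n \in K_n$ be an element such that every element of $K_n$ can be written as the sum of an element of the $F$-linear span of $\{\sigma(\pi_n) : \sigma \in G_n\}$ and an element of $K_{n-1}$. Set $\pi_n' = \pi_n - \tfrac{1}{d}\,\mathrm{Tr}_{K_n/K_{n-1}}(\pi_n)$. Then the $F$-linear span of $\{\sigma(\pi_n') : \sigma \in G_n\}$ is exactly the kernel $K^{(n)}$ of the trace map $\mathrm{Tr}_{K_n/K_{n-1}} : K_n \to K_{n-1}$. -/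
/-- if the Galois conjugates of `πₙ` together with `K_{n-1}` span `Kₙ`
over `F`, then the conjugates of `πₙ' = πₙ - (1/d)·Tr_{Kₙ/K_{n-1}}(πₙ)` span exactly
the kernel of the trace `Tr_{Kₙ/K_{n-1}} : Kₙ → K_{n-1}` as an `F`-vector space. -/
theorem stmt0 (F K1 K2 : Type*) [Field F] [CharZero F] [Field K1] [Field K2]
    [Algebra F K1] [Algebra F K2] [Algebra K1 K2] [IsScalarTower F K1 K2]
    [FiniteDimensional F K2] [IsGalois F K1] [IsGalois F K2]
    (πn : K2)
    (hspan : ∀ x : K2,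
      ∃ y ∈ Submodule.span F (Set.range fun σ : K2 ≃ₐ[F] K2 => σ πn),
        ∃ z : K1, x = y + algebraMap K1 K2 z)
    (πn' : K2)
    (hπn' : πn' = πn -
      ((Module.finrank K1 K2 : K2))⁻¹ * algebraMap K1 K2 (Algebra.trace K1 K2 πn)) :
    Submodule.span F (Set.range fun σ : K2 ≃ₐ[F] K2 => σ πn')
      = LinearMap.ker ((Algebra.trace K1 K2).restrictScalars F) := by
  have hfin : FiniteDimensional K1 K2 := FiniteDimensional.right F K1 K2
  have : CharZero K1 := charZero_of_injective_algebraMap (algebraMap F K1).injective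
  have : CharZero K2 := charZero_of_injective_algebraMap (algebraMap F K2).injective
  have hd1 : (Module.finrank K1 K2 : K1) ≠ 0 := by
    exact_mod_cast (Module.finrank_pos (R := K1) (M := K2)).ne'
  have hd2 : (Module.finrank K1 K2 : K2) ≠ 0 := by
    exact_mod_cast (Module.finrank_pos (R := K1) (M := K2)).ne'
  have htr : ∀ (σ : K2 ≃ₐ[F] K2) (x : K2),
      algebraMap K1 K2 (Algebra.trace K1 K2 (σ x))
        = σ (algebraMap K1 K2 (Algebra.trace K1 K2 x)) := by
    intro σ x
    have h := Algebra.trace_eq_of_equiv_equiv (σ.restrictNormal K1).toRingEquiv σ.toRingEquiv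
      (by ext a; exact AlgEquiv.restrictNormal_commutes σ K1 a) x
    have h2 : Algebra.trace K1 K2 (σ x) = σ.restrictNormal K1 (Algebra.trace K1 K2 x) := by
      rw [h]
      exact ((σ.restrictNormal K1).apply_symm_apply _).symm
    rw [h2]
    exact AlgEquiv.restrictNormal_commutes σ K1 _
  let P : K2 →ₗ[F] K2 := LinearMap.id -
    (LinearMap.mulLeft F ((Module.finrank K1 K2 : K2))⁻¹) ∘ₗ
      ((Algebra.linearMap K1 K2 ∘ₗ Algebra.trace K1 K2).restrictScalars F)
  have hP : ∀ x, P x = x -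
      ((Module.finrank K1 K2 : K2))⁻¹ * algebraMap K1 K2 (Algebra.trace K1 K2 x) :=
    fun x => rfl
  have hset : (Set.range fun σ : K2 ≃ₐ[F] K2 => σ πn')
      = P '' (Set.range fun σ : K2 ≃ₐ[F] K2 => σ πn) := by
    rw [← Set.range_comp]
    congr 1
    funext σ
    simp only [Function.comp, hP, htr, hπn', map_sub, map_mul, map_inv₀, map_natCast]
  have hPz : ∀ z : K1, P (algebraMap K1 K2 z) = 0 := by
    intro z
    rw [hP, Algebra.trace_algebraMap, nsmul_eq_mul, map_mul, map_natCast,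
      inv_mul_cancel_left₀ hd2, sub_self]
  have hPt : ∀ x, Algebra.trace K1 K2 (P x) = 0 := by
    intro x
    have : P x = x - algebraMap K1 K2
        (((Module.finrank K1 K2 : K1))⁻¹ * Algebra.trace K1 K2 x) := by
      rw [hP, map_mul, map_inv₀, map_natCast]
    rw [this, map_sub, Algebra.trace_algebraMap, nsmul_eq_mul,
      mul_inv_cancel_left₀ hd1, sub_self]
  rw [hset, Submodule.span_image]
  apply le_antisymm
  · rintro _ ⟨y, -, rfl⟩
    exact hPt y
  · intro x hx
    have hx' : Algebra.trace K1 K2 x = 0 := hx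
    obtain ⟨y, hy, z, hz⟩ := hspan x
    refine ⟨y, hy, ?_⟩
    have h1 : P x = x := by rw [hP, hx', map_zero, mul_zero, sub_zero]
    have h2 : P x = P y := by rw [hz, map_add, hPz, add_zero]
    exact h2.symm.trans h1
end

section
/- Let $F$ be a field of characteristic zero and let $F = K_0 \subseteq K_1 \subseteq \cdots \subseteq K_n$ be a tower of finite field extensions such that $K_i/F$ is Galois for every $1 \le i \le n$. For $1 \le i \le n$ let $K^{(i)}$ denote the kernel of the trace map $\mathrm{Tr}_{K_i/K_{i-1}} : K_i \to K_{i-1}$, regarded as an $F$-subspace of $K_n$, and set $K^{(0)} = F$. Suppose that for each $1 \le i \le n$ we are given $\pi_i' \in K^{(i)}$ whose Galois conjugates $\{\sigma(\pi_i') : \sigma \in \mathrm{Gal}(K_i/F)\}$ span $K^{(i)}$ over $F$, and set $\pi_0' = 1$. Then for any $x_0, \ldots, x_n \in F$ and $\alpha = \sum_{i=0}^n x_i \pi_i'$, the $F$-linear span of $\{\sigma(\alpha) : \sigma \in \mathrm{Gal}(K_n/F)\}$ equals $\bigoplus_{i \in S} K^{(i)}$, where $S = \{ i : x_i \ne 0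 \}$ (the sum of the subspaces $K^{(i)}$ for $i \in S$, which is a direct sum). -/
set_option synthInstance.maxHeartbeats 400000 in
open scoped Classical in
/-- The kernel of the trace map `Tr_{E'/E} : E' → E` between two intermediate fields
`E ≤ E'` of `K/F`, regarded as an `F`-subspace of `K`. (Junk value `⊥` if `¬ E ≤ E'`.) -/
noncomputable def traceKernel (F : Type*) {K : Type*} [Field F] [Field K] [Algebra F K]
    (E E' : IntermediateField F K) : Submodule F K :=
  if h : E ≤ E' then
    (Submodule.map (IntermediateField.extendScalars h).val.toLinearMap
      (LinearMap.ker
        (Algebra.trace ↥E ↥(IntermediateField.extendScalars h)))).restrictScalars F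
  else ⊥


noncomputable instance fixFintype {F K : Type*} [Field F] [Field K] [Algebra F K]
    [FiniteDimensional F K] (E : IntermediateField F K) : Fintype E.fixingSubgroup :=
  Fintype.ofFinite _

noncomputable def avgT {F K : Type*} [Field F] [Field K] [Algebra F K]
    [FiniteDimensional F K] (E : IntermediateField F K) : K →ₗ[F] K :=
  (Fintype.card E.fixingSubgroup : F)⁻¹ •
    ∑ τ : E.fixingSubgroup, (τ : K ≃ₐ[F] K).toLinearMap

theorem avgT_apply {F K : Type*} [Field F] [Field K] [Algebra F K]
    [FiniteDimensional F K] (E : IntermediateField F K) (y : K) :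
    avgT E y = (Fintype.card E.fixingSubgroup : F)⁻¹ •
      ∑ τ : E.fixingSubgroup, (τ : K ≃ₐ[F] K) y := by
  simp only [avgT, LinearMap.smul_apply, LinearMap.sum_apply]
  rfl

theorem avgT_of_mem {F K : Type*} [Field F] [CharZero F] [Field K] [Algebra F K]
    [FiniteDimensional F K] (E : IntermediateField F K) (y : K) (hy : y ∈ E) :
    avgT E y = y := by
  rw [avgT_apply, Finset.sum_congr rfl (fun τ _ => 
    (IntermediateField.mem_fixingSubgroup_iff E τ.1).1 τ.2 y hy)]
  rw [Finset.sum_const, Finset.card_univ, ← Nat.cast_smul_eq_nsmul F, smul_smul,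
      inv_mul_cancel₀, one_smul]
  exact Nat.cast_ne_zero.mpr Fintype.card_ne_zero

theorem avgT_smul {F K : Type*} [Field F] [Field K] [Algebra F K]
    [FiniteDimensional F K] (E : IntermediateField F K) (y : K)
    (τ : E.fixingSubgroup) : avgT E ((τ : K ≃ₐ[F] K) y) = avgT E y := by
  rw [avgT_apply, avgT_apply]
  congr 1
  exact Fintype.sum_equiv (Equiv.mulRight τ) _ _ (fun σ => by simp)

theorem avgT_avgT {F K : Type*} [Field F] [CharZero F] [Field K] [Algebra F K]
    [FiniteDimensional F K] (E E' : IntermediateField F K) (h : E ≤ E') (y : K) :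
    avgT E (avgT E' y) = avgT E y := by
  rw [avgT_apply E', map_smul, map_sum, Finset.sum_congr rfl (fun τ _ => 
    avgT_smul E y ⟨τ.1, IntermediateField.fixingSubgroup_antitone h τ.2⟩)]
  rw [Finset.sum_const, Finset.card_univ, ← Nat.cast_smul_eq_nsmul F, smul_smul,
      inv_mul_cancel₀, one_smul]
  exact Nat.cast_ne_zero.mpr Fintype.card_ne_zero

theorem avgT_ker {F K : Type*} [Field F] [CharZero F] [Field K] [Algebra F K]
    [FiniteDimensional F K] [IsGalois F K] (E E' : IntermediateField F K) (h : E ≤ E')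
    (y : K) (hy : y ∈ traceKernel F E E') : avgT E y = 0 := by
  rw [traceKernel, dif_pos h] at hy
  obtain ⟨z, hz, rfl⟩ := hy
  have hz : Algebra.trace E (IntermediateField.extendScalars h) z = 0 := hz
  have h1 : Algebra.trace E K (z : K) = 0 := by
    rw [← Algebra.trace_trace (S := IntermediateField.extendScalars h)]
    have : (z : K) = algebraMap (IntermediateField.extendScalars h) K z := rfl
    rw [this, Algebra.trace_algebraMap, map_nsmul, hz, smul_zero]
  have h2 := trace_eq_sum_automorphisms (K := E) (z : K)
  rw [h1, map_zero] at h2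
  have h3 : ∑ τ : E.fixingSubgroup, (τ : K ≃ₐ[F] K) (z : K) = ∑ σ : K ≃ₐ[E] K, σ (z : K) :=
    Fintype.sum_equiv (IntermediateField.fixingSubgroupEquiv E).toEquiv _ _ (fun σ => rfl)
  change avgT E (z : K) = 0
  rw [avgT_apply, h3, ← h2, smul_zero]

theorem avgT_stable {F K : Type*} [Field F] [Field K] [Algebra F K]
    [FiniteDimensional F K] (E : IntermediateField F K) (V : Submodule F K)
    (hV : ∀ σ : K ≃ₐ[F] K, ∀ v ∈ V, σ v ∈ V) (v : K) (hv : v ∈ V) : avgT E v ∈ V := by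
  rw [avgT_apply]
  exact V.smul_mem _ (V.sum_mem fun τ _ => hV _ _ hv)

/-- if the Galois conjugates of `πᵢ'` span the trace kernel
`K⁽ⁱ⁾ = ker (Tr_{Kᵢ/K_{i-1}})` over `F` for `1 ≤ i ≤ n`, and `π₀' = 1`, then for
`α = ∑ xᵢ πᵢ'` the `F`-span of the `Gal(Kₙ/F)`-conjugates of `α` is the (direct) sum
`⊕_{i ∈ S} K⁽ⁱ⁾`, where `S = {i : xᵢ ≠ 0}` and `K⁽⁰⁾ = F`. -/
theorem stmt1 (F K : Type*) [Field F] [CharZero F] [Field K] [Algebra F K]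
    [FiniteDimensional F K]
    (n : ℕ) (Ki : ℕ → IntermediateField F K)
    (hbot : Ki 0 = ⊥) (htop : Ki n = ⊤)
    (hchain : ∀ i < n, Ki i ≤ Ki (i + 1))
    (hgal : ∀ i, 1 ≤ i → i ≤ n → IsGalois F (Ki i))
    (W : ℕ → Submodule F K)
    (hW0 : W 0 = LinearMap.range (Algebra.linearMap F K))
    (hW : ∀ i, 1 ≤ i → i ≤ n → W i = traceKernel F (Ki (i - 1)) (Ki i))
    (π : (i : ℕ) → Ki i)
    (hπ0 : (π 0 : K) = 1)
    (hπmem : ∀ i, 1 ≤ i → i ≤ n → (π i : K) ∈ W i)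
    (hπspan : ∀ i, 1 ≤ i → i ≤ n →
      Submodule.span F (Set.range fun σ : Ki i ≃ₐ[F] Ki i => (σ (π i) : K)) = W i)
    (x : ℕ → F) (α : K)
    (hα : α = ∑ i ∈ Finset.range (n + 1), x i • (π i : K)) :
    Submodule.span F (Set.range fun σ : K ≃ₐ[F] K => σ α)
      = (⨆ i ∈ Finset.range (n + 1), ⨆ _ : x i ≠ 0, W i) ∧
    iSupIndep (fun i : {i : ℕ // i ∈ Finset.range (n + 1) ∧ x i ≠ 0} => W i) := by
  have hG : IsGalois F K := by
    rcases Nat.eq_zero_or_pos n with h0 | h0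
    · subst h0
      have : (⊥ : IntermediateField F K) = ⊤ := hbot.symm.trans htop
      have h2 : IsGalois F (⊥ : IntermediateField F K) := inferInstance
      rw [this] at h2
      exact IsGalois.of_algEquiv IntermediateField.topEquiv
    · have h2 := hgal n h0 le_rfl
      rw [htop] at h2
      exact IsGalois.of_algEquiv IntermediateField.topEquiv
  have hmono : ∀ i j, i ≤ j → j ≤ n → Ki i ≤ Ki j := by
    intro i j hij
    induction j, hij using Nat.le_induction with
    | base => intro _; exact le_rfl
    | succ k hk ih => intro h; exact (ih (by omega)).trans (hchain k (by omega))
  have hspan : ∀ i ≤ n, Submodule.span F (Set.range fun σ : K ≃ₐ[F] K => σ (π i : K)) = W i := by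
    intro i hi
    rcases Nat.eq_zero_or_pos i with h0 | h0
    · subst h0
      rw [hW0, hπ0]
      simp only [map_one, Set.range_const]
      ext y
      simp [Submodule.mem_span_singleton, Algebra.smul_def]
    · rw [← hπspan i h0 hi]
      have := hgal i h0 hi
      congr 1
      ext y
      constructor
      · rintro ⟨σ, rfl⟩
        exact ⟨σ.restrictNormal (Ki i), AlgEquiv.restrictNormal_commutes σ (Ki i) (π i)⟩
      · rintro ⟨σ, rfl⟩
        refine ⟨σ.liftNormal K, ?_⟩
        exact AlgEquiv.liftNormal_commutes σ K (π i)
  have hWK : ∀ i ≤ n, ∀ y ∈ W i, y ∈ Ki i := by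
    intro i hi
    rcases Nat.eq_zero_or_pos i with h0 | h0
    · subst h0
      rw [hW0]
      rintro _ ⟨c, rfl⟩
      exact (Ki 0).algebraMap_mem c
    · have : W i ≤ (Ki i).toSubalgebra.toSubmodule := by
        rw [← hπspan i h0 hi, Submodule.span_le]
        rintro _ ⟨σ, rfl⟩
        exact (σ (π i)).2
      exact fun y hy => this hy
  have hπW : ∀ i ≤ n, (π i : K) ∈ W i := by
    intro i hi
    rw [← hspan i hi]
    exact Submodule.subset_span ⟨1, rfl⟩
  have e1 : ∀ i j, j ≤ i → i ≤ n → ∀ y ∈ W j, avgT (Ki i) y = y := fun i j hji hi y hy =>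
    avgT_of_mem _ _ (hmono j i hji hi (hWK j (hji.trans hi) y hy))
  have e0 : ∀ i j, i < j → j ≤ n → ∀ y ∈ W j, avgT (Ki i) y = 0 := by
    intro i j hij hj y hy
    rw [hW j (by omega) hj] at hy
    rw [← avgT_avgT (Ki i) (Ki (j-1)) (hmono _ _ (by omega) (by omega)),
      avgT_ker _ _ (hmono _ _ (by omega) hj) y hy, map_zero]
  obtain ⟨p, hp⟩ : ∃ p : ℕ → K →ₗ[F] K, ∀ i, p i =
      if i = 0 then avgT (Ki 0) else avgT (Ki i) - avgT (Ki (i-1)) := ⟨_, fun _ => rfl⟩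
  have p1 : ∀ i ≤ n, ∀ y ∈ W i, p i y = y := by
    intro i hi y hy
    rw [hp]
    split_ifs with h
    · subst h; exact e1 0 0 le_rfl hi y hy
    · rw [LinearMap.sub_apply, e1 i i le_rfl hi y hy, e0 (i-1) i (by omega) hi y hy, sub_zero]
  have p0 : ∀ i ≤ n, ∀ j ≤ n, j ≠ i → ∀ y ∈ W j, p i y = 0 := by
    intro i hi j hj hji y hy
    rw [hp]
    split_ifs with h
    · subst h; exact e0 0 j (by omega) hj y hy
    · rw [LinearMap.sub_apply]
      rcases lt_or_gt_of_ne hji with h1 | h1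
      · rw [e1 i j h1.le hi y hy, e1 (i-1) j (by omega) (by omega) y hy, sub_self]
      · rw [e0 i j h1 hj y hy, e0 (i-1) j (by omega) hj y hy, sub_self]
  refine ⟨le_antisymm ?_ ?_, ?_⟩
  · rw [Submodule.span_le]
    rintro _ ⟨σ, rfl⟩
    simp only [hα, map_sum, map_smul]
    refine Submodule.sum_mem _ fun i hi => ?_
    by_cases hx : x i = 0
    · simp [hx]
    · refine Submodule.smul_mem _ _ ?_
      have hm : σ (π i : K) ∈ W i := by
        rw [← hspan i (by simpa [Nat.lt_succ_iff] using hi)]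
        exact Submodule.subset_span ⟨σ, rfl⟩
      have hle : W i ≤ ⨆ i ∈ Finset.range (n + 1), ⨆ _ : x i ≠ 0, W i :=
        le_iSup₂_of_le i hi (le_iSup (fun _ : x i ≠ 0 => W i) hx)
      exact hle hm
  · have hV : ∀ σ : K ≃ₐ[F] K,
        ∀ v ∈ Submodule.span F (Set.range fun σ : K ≃ₐ[F] K => σ α),
        σ v ∈ Submodule.span F (Set.range fun σ : K ≃ₐ[F] K => σ α) := by
      intro σ v hv
      induction hv using Submodule.span_induction with
      | mem y hy =>
        obtain ⟨τ, rfl⟩ := hy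
        exact Submodule.subset_span ⟨σ * τ, rfl⟩
      | zero => simp
      | add a b _ _ ha hb => rw [map_add]; exact Submodule.add_mem _ ha hb
      | smul c a _ ha => rw [map_smul]; exact Submodule.smul_mem _ _ ha
    have hαV : α ∈ Submodule.span F (Set.range fun σ : K ≃ₐ[F] K => σ α) :=
      Submodule.subset_span ⟨1, rfl⟩
    generalize Submodule.span F (Set.range fun σ : K ≃ₐ[F] K => σ α) = V at hV hαV ⊢
    refine iSup₂_le fun i hi => iSup_le fun hx => ?_
    have hin : i ≤ n := by simpa [Nat.lt_succ_iff] using hi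
    have hpα : p i α = x i • (π i : K) := by
      rw [hα, map_sum, Finset.sum_eq_single_of_mem i hi]
      · rw [map_smul, p1 i hin _ (hπW i hin)]
      · intro j hj hji
        have hjn : j ≤ n := by simpa [Nat.lt_succ_iff] using hj
        rw [map_smul, p0 i hin j hjn hji _ (hπW j hjn), smul_zero]
    have hpV : p i α ∈ V := by
      rw [hp]
      split_ifs
      · exact avgT_stable _ V hV _ hαV
      · exact V.sub_mem (avgT_stable _ V hV _ hαV) (avgT_stable _ V hV _ hαV)
    rw [hpα] at hpV
    have hπV : (π i : K) ∈ V := (V.smul_mem_iff hx).1 hpV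
    rw [← hspan i hin, Submodule.span_le]
    rintro _ ⟨σ, rfl⟩
    exact hV σ _ hπV
  · rw [iSupIndep_def]
    rintro ⟨i, hi, hx⟩
    have hin : i ≤ n := by simpa [Nat.lt_succ_iff] using hi
    rw [Submodule.disjoint_def]
    intro y hy hy'
    have hle : (⨆ j : {i : ℕ // i ∈ Finset.range (n + 1) ∧ x i ≠ 0},
        ⨆ _ : j ≠ ⟨i, hi, hx⟩, W j) ≤ LinearMap.ker (p i) := by
      refine iSup₂_le ?_
      rintro ⟨j, hj, hxj⟩ hne z hz
      exact p0 i hin j (by simpa [Nat.lt_succ_iff] using hj)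
        (fun h => hne (Subtype.ext h)) z hz
    rw [← p1 i hin y hy]
    exact hle hy'
end

section
/- Let $p$ be a prime, let $B$ be a vector space over $\mathbb{Q}_p$, let $\varphi : B \to B$ be a $\mathbb{Q}_p$-linear map, and let $\mu : C(\mathbb{Z}_p, \mathbb{Q}_p) \to B$ be a $\mathbb{Q}_p$-linear map satisfying the invariance property: for every continuous function $f : \mathbb{Z}_p \to \mathbb{Q}_p$, $\mu(\mathbf{1}_{p\mathbb{Z}_p} \cdot f) = \varphi\big(\mu(x \mapsto f(px))\big)$, where $\mathbf{1}_{p\mathbb{Z}_p}$ is the indicator function of the clopen subset $p\mathbb{Z}_p \subseteq \mathbb{Z}_p$. Let $k \ge 0$ be an integer such that $1 - p^k\varphi$ is bijective on $B$. Then $\mu(x \mapsto x^k) = (1 - p^k\varphi)^{-1}\big(\mu(x \mapsto x^k\,\mathbf{1}_{\mathbb{Z}_p^\times}(x))\big)$, where $\mathbf{1}_{\mathbb{Z}_p^\times}$ is the indicator function of the clopen subset of units $\mathbb{Z}_p^\times = \{ x \in \mathbb{Z}_p : |x|_p = 1 \}$. -/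
/-- The indicator function of a clopen subset `U ⊆ X`, as a continuous map. -/
noncomputable def clopenIndicatorCM {X : Type*} (R : Type*) [TopologicalSpace X]
    [TopologicalSpace R] [MulZeroOneClass R] {U : Set X} (hU : IsClopen U) : C(X, R) :=
  (LocallyConstant.charFn R hU).toContinuousMap

/-- `pℤ_p = {x ∈ ℤ_p : p ∣ x}` is clopen in `ℤ_p`. -/
lemma isClopen_pZp (p : ℕ) [Fact p.Prime] : IsClopen {x : ℤ_[p] | (p : ℤ_[p]) ∣ x} := by
  have h : {x : ℤ_[p] | (p : ℤ_[p]) ∣ x} = Metric.ball 0 1 := by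
    ext x
    simp [Metric.mem_ball, dist_eq_norm, PadicInt.norm_lt_one_iff_dvd]
  rw [h]
  exact IsUltrametricDist.isClopen_ball 0 1

/-- `ℤ_p^× = {x ∈ ℤ_p : |x|_p = 1}` is clopen in `ℤ_p`. -/
lemma isClopen_unitSet (p : ℕ) [Fact p.Prime] : IsClopen {x : ℤ_[p] | ‖x‖ = 1} := by
  have h : {x : ℤ_[p] | ‖x‖ = 1} = (Metric.ball (0 : ℤ_[p]) 1)ᶜ := by
    ext x
    simp only [Set.mem_setOf_eq, Set.mem_compl_iff, Metric.mem_ball, dist_zero_right, not_lt]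
    exact ⟨fun h => h.ge, fun h => le_antisymm (PadicInt.norm_le_one x) h⟩
  rw [h]
  exact (IsUltrametricDist.isClopen_ball 0 1).compl

/-- Multiplication by `p` on `ℤ_p`, as a continuous map. -/
noncomputable def pMulCM (p : ℕ) [Fact p.Prime] : C(ℤ_[p], ℤ_[p]) :=
  ⟨fun x => (p : ℤ_[p]) * x, by fun_prop⟩

/-- The function `x ↦ x^k` on `ℤ_p`, with values in `ℚ_p`, as a continuous map. -/
noncomputable def monomialCM (p : ℕ) [Fact p.Prime] (k : ℕ) : C(ℤ_[p], ℚ_[p]) :=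
  ⟨fun x => (x : ℚ_[p]) ^ k, (continuous_subtype_val.pow k)⟩

/-- for a distribution-like linear functional `μ` on `C(ℤ_p, ℚ_p)`
satisfying `μ(𝟙_{pℤ_p}·f) = φ(μ(x ↦ f(px)))`, and `k ≥ 0` with `1 - p^k φ` bijective,
one has `μ(x^k) = (1 - p^k φ)⁻¹ (μ(x^k 𝟙_{ℤ_p^×}))`. -/
theorem stmt4 (p : ℕ) [Fact p.Prime] (B : Type*) [AddCommGroup B] [Module ℚ_[p] B]
    (φ : B →ₗ[ℚ_[p]] B) (μ : C(ℤ_[p], ℚ_[p]) →ₗ[ℚ_[p]] B)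
    (hinv : ∀ f : C(ℤ_[p], ℚ_[p]),
      μ (clopenIndicatorCM ℚ_[p] (isClopen_pZp p) * f) = φ (μ (f.comp (pMulCM p))))
    (k : ℕ)
    (hbij : Function.Bijective ((LinearMap.id : B →ₗ[ℚ_[p]] B) - (p : ℚ_[p]) ^ k • φ)) :
    μ (monomialCM p k) =
      (LinearEquiv.ofBijective ((LinearMap.id : B →ₗ[ℚ_[p]] B) - (p : ℚ_[p]) ^ k • φ)
          hbij).symm
        (μ (monomialCM p k * clopenIndicatorCM ℚ_[p] (isClopen_unitSet p))) := by
  rw [LinearEquiv.eq_symm_apply, LinearEquiv.ofBijective_apply]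
  have h1 : (monomialCM p k).comp (pMulCM p) = (p : ℚ_[p]) ^ k • monomialCM p k := by
    ext x
    change (((p : ℤ_[p]) * x : ℤ_[p]) : ℚ_[p]) ^ k = (p : ℚ_[p]) ^ k * (x : ℚ_[p]) ^ k
    rw [PadicInt.coe_mul, PadicInt.coe_natCast, mul_pow]
  have h2 : monomialCM p k = clopenIndicatorCM ℚ_[p] (isClopen_pZp p) * monomialCM p k
      + monomialCM p k * clopenIndicatorCM ℚ_[p] (isClopen_unitSet p) := by
    ext x
    have hx : (p : ℤ_[p]) ∣ x ↔ ¬ ‖x‖ = 1 := by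
      rw [← PadicInt.norm_lt_one_iff_dvd]
      exact ⟨fun h => h.ne, fun h => lt_of_le_of_ne (PadicInt.norm_le_one x) h⟩
    by_cases h : ‖x‖ = 1
    · simp [clopenIndicatorCM, LocallyConstant.charFn, Set.indicator, hx, h]
    · simp [clopenIndicatorCM, LocallyConstant.charFn, Set.indicator, hx, h]
  have h3 := congrArg μ h2
  rw [map_add, hinv, h1, map_smul, map_smul] at h3
  rw [LinearMap.sub_apply, LinearMap.id_apply, LinearMap.smul_apply, sub_eq_iff_eq_add']
  exact h3
end

section
/- Let $p$ be a prime and $n \ge 1$ an integer. Let $E$ be a nonarchimedean normed field extension of $\mathbb{Q}_p$ containing a primitive $p^n$-th root of unity $\zeta$. Let $B$ be an $E$-vector space, $\varphi : B \to B$ an $E$-linear map, and $\mu : C(\mathbb{Z}_p, E) \to B$ an $E$-linear map satisfying: for every continuous $f : \mathbb{Z}_p \to E$, $\mu(\mathbf{1}_{p\mathbb{Z}_p} \cdot f) = \varphi\big(\mu(x \mapsto f(px))\big)$. For $0 \le m \le n$ let $\epsilon_m : \mathbb{Z}_p \to E$ be the locally constant function $\epsilon_m(x) = (\zeta^{p^{n-m}})^{a}$,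 where $a \in \{0, 1, \ldots, p^m - 1\}$ is the residue of $x$ modulo $p^m$ (so $\zeta^{p^{n-m}}$ is a primitive $p^m$-th root of unity and $\epsilon_0 \equiv 1$). Let $k \ge 0$ be an integer such that $1 - p^k\varphi$ is bijective on $B$. Then $\mu\big(x \mapsto \epsilon_n(x)\,x^k\big) = \sum_{i=0}^{n-1} p^{ik}\,\varphi^i\Big(\mu\big(x \mapsto \epsilon_{n-i}(x)\,x^k\,\mathbf{1}_{\mathbb{Z}_p^\times}(x)\big)\Big) + p^{nk}\,\varphi^n\Big((1 - p^k\varphi)^{-1}\big(\mu(x \mapsto x^k\,\mathbf{1}_{\mathbb{Z}_p^\times}(x))\big)\Big). -/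
/-- Any function of the residue of `x` modulo `p^m` is a continuous (locally constant)
function on `ℤ_p`. -/
lemma continuous_of_toZModPow (p : ℕ) [Fact p.Prime] {E : Type*} [TopologicalSpace E]
    (m : ℕ) (g : ZMod (p ^ m) → E) :
    Continuous fun x : ℤ_[p] => g (PadicInt.toZModPow m x) := by
  refine IsLocallyConstant.continuous ?_
  refine (IsLocallyConstant.iff_exists_open _).mpr fun x => ?_
  have hp : (0 : ℝ) < (p : ℝ) ^ (-(m : ℤ)) := by
    have : (0 : ℝ) < (p : ℝ) := by exact_mod_cast (Fact.out : p.Prime).pos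
    exact zpow_pos this _
  refine ⟨Metric.closedBall x ((p : ℝ) ^ (-(m : ℤ))),
    IsUltrametricDist.isOpen_closedBall x hp.ne', Metric.mem_closedBall_self hp.le,
    fun y hy => ?_⟩
  have hmem : y - x ∈ Ideal.span {(p : ℤ_[p]) ^ m} := by
    rw [← PadicInt.norm_le_pow_iff_mem_span_pow]
    simpa [dist_eq_norm] using (Metric.mem_closedBall.mp hy)
  rw [← PadicInt.ker_toZModPow, RingHom.mem_ker, map_sub, sub_eq_zero] at hmem
  rw [hmem]

/-- The locally constant function `ε_m : ℤ_p → E`, `ε_m(x) = (ζ^{p^{n-m}})^a` where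
`a` is the residue of `x` modulo `p^m` (so that `ε_m(x) = ζ_{p^m}^x`). -/
noncomputable def epsilonCM (p : ℕ) [Fact p.Prime] {E : Type*} [NormedField E]
    (ζ : E) (n m : ℕ) : C(ℤ_[p], E) :=
  ⟨fun x => (ζ ^ p ^ (n - m)) ^ (PadicInt.toZModPow m x).val,
    continuous_of_toZModPow p m fun a => (ζ ^ p ^ (n - m)) ^ a.val⟩

/-- The function `x ↦ x^k` on `ℤ_p`, with values in a normed field extension `E` of
`ℚ_p`, as a continuous map. -/
noncomputable def monomialCME (p : ℕ) [Fact p.Prime] (E : Type*) [NormedField E]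
    [NormedAlgebra ℚ_[p] E] (k : ℕ) : C(ℤ_[p], E) :=
  ⟨fun x => algebraMap ℚ_[p] E (x : ℚ_[p]) ^ k,
    ((continuous_algebraMap ℚ_[p] E).comp continuous_subtype_val).pow k⟩

lemma split_aux (p : ℕ) [Fact p.Prime] (E : Type*) [NormedField E] (f : C(ℤ_[p], E)) :
    f = f * clopenIndicatorCM E (isClopen_unitSet p) +
      clopenIndicatorCM E (isClopen_pZp p) * f := by
  ext x
  have h1 : ‖x‖ = 1 ↔ ¬ (p : ℤ_[p]) ∣ x := by
    rw [← PadicInt.norm_lt_one_iff_dvd, not_lt]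
    exact ⟨fun h => h.ge, fun h => le_antisymm (PadicInt.norm_le_one x) h⟩
  by_cases h : (p : ℤ_[p]) ∣ x <;>
    simp [clopenIndicatorCM, LocallyConstant.charFn, Set.indicator, h1, h]

lemma mono_aux (p : ℕ) [Fact p.Prime] (E : Type*) [NormedField E]
    [NormedAlgebra ℚ_[p] E] (k : ℕ) :
    (monomialCME p E k).comp (pMulCM p) = (p : E) ^ k • monomialCME p E k := by
  ext x
  change algebraMap ℚ_[p] E (((p : ℤ_[p]) * x : ℤ_[p]) : ℚ_[p]) ^ k =
    (p : E) ^ k * algebraMap ℚ_[p] E (x : ℚ_[p]) ^ k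
  simp [mul_pow]

lemma eps_aux (p : ℕ) [Fact p.Prime] {E : Type*} [NormedField E] (ζ : E) (n m : ℕ)
    (hζ : ζ ^ p ^ n = 1) (hm : m + 1 ≤ n) :
    (epsilonCM p ζ n (m + 1)).comp (pMulCM p) = epsilonCM p ζ n m := by
  have key : ∀ (j : ℕ), j ≤ n → ∀ (x : ℤ_[p]) (a : ℕ), PadicInt.toZModPow j x = (a : ZMod (p ^ j)) →
      epsilonCM p ζ n j x = (ζ ^ p ^ (n - j)) ^ a := by
    intro j hj x a h
    change (ζ ^ p ^ (n - j)) ^ (PadicInt.toZModPow j x).val = _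
    rw [h, ZMod.val_natCast]
    refine (pow_eq_pow_mod a ?_).symm
    rw [← pow_mul, ← pow_add, Nat.sub_add_cancel hj, hζ]
  ext x
  have hp : NeZero (p ^ (m + 1)) := ⟨pow_ne_zero _ (Fact.out : p.Prime).ne_zero⟩
  have ha : PadicInt.toZModPow (m + 1) x =
      (((PadicInt.toZModPow (m + 1) x).val : ℕ) : ZMod (p ^ (m + 1))) := by simp
  generalize (PadicInt.toZModPow (m + 1) x).val = a at ha
  have ha' : PadicInt.toZModPow m x = (a : ZMod (p ^ m)) := by
    rw [← PadicInt.cast_toZModPow m (m + 1) (Nat.le_succ m) x, ha,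
      ZMod.cast_natCast (pow_dvd_pow p (Nat.le_succ m))]
  have hpa : PadicInt.toZModPow (m + 1) ((p : ℤ_[p]) * x) =
      ((p * a : ℕ) : ZMod (p ^ (m + 1))) := by
    rw [map_mul, ha, map_natCast, Nat.cast_mul]
  rw [key m (by omega) x a ha']
  change epsilonCM p ζ n (m + 1) ((p : ℤ_[p]) * x) = _
  rw [key (m + 1) hm _ _ hpa, pow_mul, ← pow_mul ζ, ← pow_succ]
  congr 3
  omega

/-- for a distribution-like linear functional `μ` on `C(ℤ_p, E)`
satisfying `μ(𝟙_{pℤ_p}·f) = φ(μ(x ↦ f(px)))`, a primitive `p^n`-th root of unity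
`ζ ∈ E`, and `k ≥ 0` with `1 - p^k φ` bijective, one has
`μ(ε_n x^k) = ∑_{i<n} p^{ik} φ^i (μ(ε_{n-i} x^k 𝟙_{ℤ_p^×}))
  + p^{nk} φ^n ((1 - p^k φ)⁻¹ (μ(x^k 𝟙_{ℤ_p^×})))`. -/
theorem stmt5 (p : ℕ) [Fact p.Prime] (n : ℕ) (hn : 1 ≤ n)
    (E : Type*) [NormedField E] [NormedAlgebra ℚ_[p] E] [IsUltrametricDist E]
    (ζ : E) (hζ : IsPrimitiveRoot ζ (p ^ n))
    (B : Type*) [AddCommGroup B] [Module E B]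
    (φ : B →ₗ[E] B) (μ : C(ℤ_[p], E) →ₗ[E] B)
    (hinv : ∀ f : C(ℤ_[p], E),
      μ (clopenIndicatorCM E (isClopen_pZp p) * f) = φ (μ (f.comp (pMulCM p))))
    (k : ℕ)
    (hbij : Function.Bijective ((LinearMap.id : B →ₗ[E] B) - (p : E) ^ k • φ)) :
    μ (epsilonCM p ζ n n * monomialCME p E k) =
      (∑ i ∈ Finset.range n, (p : E) ^ (i * k) •
        (φ ^ i) (μ (epsilonCM p ζ n (n - i) * monomialCME p E k *
          clopenIndicatorCM E (isClopen_unitSet p)))) +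
      (p : E) ^ (n * k) •
        (φ ^ n) ((LinearEquiv.ofBijective
            ((LinearMap.id : B →ₗ[E] B) - (p : E) ^ k • φ) hbij).symm
          (μ (monomialCME p E k * clopenIndicatorCM E (isClopen_unitSet p)))) := by
  have hsplit : ∀ f : C(ℤ_[p], E),
      μ f = μ (f * clopenIndicatorCM E (isClopen_unitSet p)) + φ (μ (f.comp (pMulCM p))) := by
    intro f
    rw [← hinv, ← map_add, ← split_aux]
  have main : ∀ m : ℕ, m ≤ n → μ (epsilonCM p ζ n m * monomialCME p E k) =
      (∑ i ∈ Finset.range m, (p : E) ^ (i * k) •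
        (φ ^ i) (μ (epsilonCM p ζ n (m - i) * monomialCME p E k *
          clopenIndicatorCM E (isClopen_unitSet p)))) +
      (p : E) ^ (m * k) •
        (φ ^ m) ((LinearEquiv.ofBijective
            ((LinearMap.id : B →ₗ[E] B) - (p : E) ^ k • φ) hbij).symm
          (μ (monomialCME p E k * clopenIndicatorCM E (isClopen_unitSet p)))) := by
    intro m
    induction m with
    | zero =>
      intro _
      have h0 : epsilonCM p ζ n 0 = 1 := by
        ext x
        have hv : (PadicInt.toZModPow 0 x).val = 0 := by
          have := ZMod.val_lt (PadicInt.toZModPow 0 x)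
          simpa using this
        change (ζ ^ p ^ (n - 0)) ^ (PadicInt.toZModPow 0 x).val = 1
        rw [hv, pow_zero]
      have h := hsplit (monomialCME p E k)
      rw [mono_aux, map_smul, map_smul] at h
      simp only [Finset.range_zero, Finset.sum_empty, zero_add, zero_mul, pow_zero, one_smul,
        Module.End.one_apply, h0, one_mul]
      rw [LinearEquiv.eq_symm_apply, LinearEquiv.ofBijective_apply]
      simp only [LinearMap.sub_apply, LinearMap.id_apply, LinearMap.smul_apply]
      rw [sub_eq_iff_eq_add]
      exact h
    | succ m ih =>
      intro hm
      have hc : (epsilonCM p ζ n (m + 1) * monomialCME p E k).comp (pMulCM p) =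
          (p : E) ^ k • (epsilonCM p ζ n m * monomialCME p E k) := by
        rw [← mul_smul_comm, ← mono_aux, ← eps_aux p ζ n m hζ.pow_eq_one hm]
        rfl
      rw [hsplit, hc, map_smul, map_smul, ih (by omega), Finset.sum_range_succ', map_add,
        map_sum, smul_add, Finset.smul_sum]
      simp only [map_smul, smul_smul, ← pow_add, pow_succ', Module.End.mul_apply,
        Nat.add_sub_add_right, zero_mul, pow_zero, one_smul, Module.End.one_apply, Nat.sub_zero,
        add_mul, one_mul, add_comm k]
      abel
  exact main n le_rfl
end
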